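/- Let M ∈ ℝ^{2n×2n} be symmetric positive-definite with symplectic eigenvalues d₁ ≤ ... ≤ dₙ and let 1 ≤ k ≤ n. Suppose the columns of X ∈ Sp(2k,2n) form a normalized symplectic eigenvector set of M associated with symplectic eigenvalues d_{i₁}, ..., d_{i_k} (indices i₁ < ... < i_k in {1, ..., n}), and that for at least one index j one has d_k < d_{iⱼ} < d_{n−k+1}. Then X is a saddle point of f(X) = tr(XᵀMX) on Sp(2k,2n): X is neither a local minimizer nor a local maximizer of f restricted to Sp(2k,2n), i.e., for every ε > 0 there exist Y, Z ∈ Sp(2k,2n) with ‖Y − X‖ < ε, ‖Z − X‖ < ε, f(Y) < f(X) and f(Z) > f(X). -/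

import Mathlib

open Matrix

noncomputable section

/-- Index type for `2n`-dimensional objects: first copy for indices `1..n`,
second copy for indices `n+1..2n`. -/
abbrev Idx (n : ℕ) := Fin n ⊕ Fin n

/-- The Poisson matrix `J_{2n} = [[0, I], [-I, 0]]`. -/
def Jmat (n : ℕ) : Matrix (Idx n) (Idx n) ℝ := fromBlocks 0 1 (-1) 0

/-- `X ∈ Sp(2k, 2n)`, i.e. `Xᵀ J_{2n} X = J_{2k}`. -/
def Symplectic {n k : ℕ} (X : Matrix (Idx n) (Idx k) ℝ) : Prop :=
  Xᵀ * Jmat n * X = Jmat k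

/-- `K ∈ OrSp(2n)`, i.e. `KᵀK = I` and `Kᵀ J K = J`. -/
def OrthoSymplectic {n : ℕ} (K : Matrix (Idx n) (Idx n) ℝ) : Prop :=
  Kᵀ * K = 1 ∧ Symplectic K

/-- The block-diagonal matrix `diag(D, D)` with `D = diagonal d`. -/
def diagPair {n : ℕ} (d : Fin n → ℝ) : Matrix (Idx n) (Idx n) ℝ :=
  fromBlocks (diagonal d) 0 0 (diagonal d)

/-- The matrix `[[0, -Λ], [Λ, 0]]` with `Λ = diagonal lam`. -/
def offPair {k : ℕ} (lam : Fin k → ℝ) : Matrix (Idx k) (Idx k) ℝ :=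
  fromBlocks 0 (-(diagonal lam)) (diagonal lam) 0

attribute [local instance] Matrix.normedAddCommGroup

lemma Jmat_mul_Jmat (n : ℕ) : Jmat n * Jmat n = -1 := by
  rw [← fromBlocks_one, fromBlocks_neg]
  simp [Jmat, fromBlocks_multiply]

/-- The transpose inverse of a square symplectic matrix. -/
lemma Symplectic.transpose_mul_eq_one {n : ℕ} {S : Matrix (Idx n) (Idx n) ℝ}
    (hS : Symplectic S) : Sᵀ * (-(Jmat n * S * Jmat n)) = 1 := by
  have h : Sᵀ * Jmat n * S = Jmat n := hS
  rw [Matrix.mul_neg, ← Matrix.mul_assoc, ← Matrix.mul_assoc, h, Jmat_mul_Jmat, neg_neg]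

lemma Symplectic.mul_eq_of_williamson {n : ℕ} {S M : Matrix (Idx n) (Idx n) ℝ}
    {d : Fin n → ℝ} (hS : Symplectic S) (hD : Sᵀ * M * S = diagPair d) :
    M * S = -(Jmat n * S * Jmat n * diagPair d) := by
  have h := mul_eq_one_comm.mp hS.transpose_mul_eq_one
  calc M * S = (-(Jmat n * S * Jmat n) * Sᵀ) * (M * S) := by rw [h, Matrix.one_mul]
    _ = -(Jmat n * S * Jmat n) * (Sᵀ * M * S) := by simp only [Matrix.mul_assoc]
    _ = _ := by rw [hD, Matrix.neg_mul]

/-- The symplectic Gram matrix between an eigenvector set and a diagonalizing basis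
intertwines the two spectral matrices. -/
lemma offPair_transpose_mul_gram {n k : ℕ} {S M : Matrix (Idx n) (Idx n) ℝ}
    {d : Fin n → ℝ} {lam : Fin k → ℝ} {X : Matrix (Idx n) (Idx k) ℝ} (hM : Mᵀ = M)
    (hS : Symplectic S) (hD : Sᵀ * M * S = diagPair d)
    (heig : M * X = Jmat n * X * offPair lam) :
    (offPair lam)ᵀ * (Xᵀ * Jmat n * S) = Xᵀ * Jmat n * S * Jmat n * diagPair d := by
  have hJ : (Jmat n)ᵀ = -Jmat n := by simp [Jmat, fromBlocks_transpose, fromBlocks_neg]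
  have h := congrArg transpose heig
  simp only [transpose_mul, hM, hJ] at h
  have h2 : Xᵀ * M * S = Xᵀ * (M * S) := Matrix.mul_assoc _ _ _
  rw [h, hS.mul_eq_of_williamson hD] at h2
  simp only [Matrix.mul_neg, Matrix.neg_mul, neg_inj, Matrix.mul_assoc] at h2 ⊢
  exact h2

/-- Block structure of a matrix intertwining two symplectic spectral matrices: it is the real form
of a complex matrix whose entries vanish off the matching eigenvalues. -/
lemma blocks_of_offPair_transpose_mul {n k : ℕ} {d : Fin n → ℝ} {lam : Fin k → ℝ}
    (hd : ∀ m, 0 < d m) (hlam : ∀ j, 0 < lam j) {T : Matrix (Idx k) (Idx n) ℝ}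
    (hT : (offPair lam)ᵀ * T = T * Jmat n * diagPair d) (j : Fin k) (m : Fin n) :
    T (.inr j) (.inr m) = T (.inl j) (.inl m) ∧ T (.inr j) (.inl m) = -T (.inl j) (.inr m) ∧
      (lam j ≠ d m → T (.inl j) (.inl m) = 0 ∧ T (.inl j) (.inr m) = 0) := by
  rw [← fromBlocks_toBlocks T] at hT
  simp only [offPair, Jmat, diagPair, fromBlocks_transpose, fromBlocks_multiply,
    fromBlocks_inj, transpose_zero, transpose_neg, diagonal_transpose, Matrix.zero_mul,
    Matrix.mul_zero, Matrix.mul_one, Matrix.neg_mul, Matrix.mul_neg, zero_add, add_zero] at hT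
  simp only [← Matrix.ext_iff, Matrix.neg_apply, diagonal_mul, mul_diagonal, toBlocks₁₁, toBlocks₁₂,
    toBlocks₂₁, toBlocks₂₂, of_apply] at hT
  obtain ⟨h1, h2, h3, h4⟩ := hT
  have h1 := h1 j m
  have h2 := h2 j m
  have h3 := h3 j m
  have h4 := h4 j m
  have hpos : lam j + d m ≠ 0 := (add_pos (hlam j) (hd m)).ne'
  have e1 : T (.inr j) (.inr m) = T (.inl j) (.inl m) := by
    apply mul_left_cancel₀ hpos
    linarith
  have e2 : T (.inr j) (.inl m) = -T (.inl j) (.inr m) := by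
    apply mul_left_cancel₀ hpos
    linarith
  refine ⟨e1, e2, fun hne => ?_⟩
  have hne' : lam j - d m ≠ 0 := sub_ne_zero.mpr hne
  rw [e1] at h2
  rw [e2] at h1
  constructor <;> apply mul_left_cancel₀ hne' <;> linarith

/-- The columns `b = (p, q)` and `(-q, p)` placed in the `j`-th symplectic pair of columns. -/
def pairColumns {n k : ℕ} (p q : Fin n → ℝ) (j : Fin k) : Matrix (Idx n) (Idx k) ℝ :=
  fromBlocks (vecMulVec p (Pi.single j 1)) (-vecMulVec q (Pi.single j 1))
    (vecMulVec q (Pi.single j 1)) (vecMulVec p (Pi.single j 1))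

lemma transpose_vecMulVec_single_mul {n k : ℕ} (u v : Fin n → ℝ) (j : Fin k) :
    (vecMulVec u (Pi.single j (1 : ℝ)))ᵀ * vecMulVec v (Pi.single j (1 : ℝ)) =
      (u ⬝ᵥ v) • diagonal (Pi.single j (1 : ℝ)) := by
  rw [transpose_vecMulVec, vecMulVec_mul_vecMulVec]
  ext a b
  simp only [vecMulVec_apply, Matrix.smul_apply, diagonal_apply, Pi.single_apply, Pi.smul_apply,
    smul_eq_mul]
  grind

lemma pairColumns_transpose_mul_Jmat_mul {n k : ℕ} {p q : Fin n → ℝ} (j : Fin k)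
    (h : p ⬝ᵥ p + q ⬝ᵥ q = 1) :
    (pairColumns p q j)ᵀ * Jmat n * pairColumns p q j =
      fromBlocks 0 (diagonal (Pi.single j 1)) (-diagonal (Pi.single j 1)) 0 := by
  simp only [pairColumns, Jmat, fromBlocks_transpose, fromBlocks_multiply,
    transpose_neg, Matrix.mul_neg, Matrix.neg_mul, Matrix.mul_zero, Matrix.mul_one, add_zero,
    zero_add, transpose_vecMulVec_single_mul, dotProduct_comm q p, neg_neg]
  rw [fromBlocks_inj]
  refine ⟨by abel, ?_, ?_, by abel⟩
  · rw [← add_smul, add_comm, h, one_smul]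
  · rw [← neg_add, ← add_smul, h, one_smul]

lemma trace_pairColumns_transpose_mul_diagPair_mul {n k : ℕ} (p q d : Fin n → ℝ) (j : Fin k) :
    ((pairColumns p q j)ᵀ * diagPair d * pairColumns p q j).trace =
      2 * ∑ m, d m * (p m ^ 2 + q m ^ 2) := by
  have h (u : Fin n → ℝ) : diagonal d * vecMulVec u (Pi.single j (1 : ℝ) : Fin k → ℝ) =
      vecMulVec (d * u) (Pi.single j 1) := by
    ext a b
    simp [vecMulVec_apply, mul_assoc]
  simp only [pairColumns, diagPair, fromBlocks_transpose, fromBlocks_multiply, transpose_neg,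
    Matrix.mul_neg, Matrix.neg_mul, Matrix.mul_zero, add_zero, zero_add, neg_neg,
    Matrix.mul_assoc, h, transpose_vecMulVec_single_mul]
  simp only [trace, Fintype.sum_sum_type, diag_apply, fromBlocks_apply₁₁, fromBlocks_apply₂₂,
    Matrix.add_apply, Matrix.smul_apply, diagonal_apply_eq, smul_eq_mul, ← add_mul,
    ← Finset.mul_sum, Finset.sum_pi_single', Finset.mem_univ, if_true, mul_one]
  simp only [dotProduct, Pi.mul_apply, Finset.mul_sum, ← Finset.sum_add_distrib]
  exact Finset.sum_congr rfl fun m _ => by ring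

/-- A unit pair symplectically orthogonal to `T` on which the energy `d` is below `lam j`. -/
lemma exists_pairColumns {n k : ℕ} (hk : k ≤ n) {d : Fin n → ℝ}
    (hd : ∀ m, 0 < d m) {lam : Fin k → ℝ} (hlam : ∀ j, 0 < lam j)
    {T : Matrix (Idx k) (Idx n) ℝ} (hT : (offPair lam)ᵀ * T = T * Jmat n * diagPair d)
    {j : Fin k} {e : ℝ} (hfd : ∀ a : Fin k, d (Fin.castLE hk a) ≤ e) (hj : e < lam j) :
    ∃ p q : Fin n → ℝ, p ⬝ᵥ p + q ⬝ᵥ q = 1 ∧ T * pairColumns p q j = 0 ∧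
      ∑ m, d m * (p m ^ 2 + q m ^ 2) < lam j := by
  have hblk := blocks_of_offPair_transpose_mul hd hlam hT
  let f : Fin k → Fin n := Fin.castLE hk
  have hf : Function.Injective f := Fin.castLE_injective hk
  have hdet : (T.submatrix id (Sum.map f f)).det = 0 := by
    refine det_eq_zero_of_row_eq_zero (.inl j) fun x => ?_
    rcases x with a | a
    · exact ((hblk j (f a)).2.2 ((hfd a).trans_lt hj).ne').1
    · exact ((hblk j (f a)).2.2 ((hfd a).trans_lt hj).ne').2
  obtain ⟨v, hv0, hv⟩ := exists_mulVec_eq_zero_iff.mpr hdet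
  let p : Fin n → ℝ := Function.extend f (fun a => v (.inl a)) 0
  let q : Fin n → ℝ := Function.extend f (fun a => v (.inr a)) 0
  have hpf (a : Fin k) : p (f a) = v (.inl a) := hf.extend_apply _ _ a
  have hqf (a : Fin k) : q (f a) = v (.inr a) := hf.extend_apply _ _ a
  have hp0 (m : Fin n) (hm : m ∉ Set.range f) : p m = 0 := Function.extend_apply' _ _ m hm
  have hq0 (m : Fin n) (hm : m ∉ Set.range f) : q m = 0 := Function.extend_apply' _ _ m hm
  have hTv (x : Idx k) : ∑ m, (T x (.inl m) * p m + T x (.inr m) * q m) = 0 := by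
    have h := congrFun hv x
    simp only [mulVec, dotProduct, Fintype.sum_sum_type, submatrix_apply, Sum.map_inl,
      Sum.map_inr, id_eq, Pi.zero_apply, ← Finset.sum_add_distrib] at h
    rw [← h]
    symm
    refine Fintype.sum_of_injective f hf _ _ (fun m hm => ?_) fun a => ?_
    · rw [hp0 m hm, hq0 m hm]; ring
    · rw [hpf, hqf]
  have hr : 0 < ∑ m, (p m ^ 2 + q m ^ 2) := by
    refine (Finset.sum_nonneg fun m _ => by positivity).lt_of_ne fun h => hv0 ?_
    have h := (Finset.sum_eq_zero_iff_of_nonneg fun m _ => by positivity).mp h.symm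
    ext (a | a)
    · have := h (f a) (Finset.mem_univ _)
      rw [hpf, hqf] at this
      simp only [Pi.zero_apply]
      nlinarith [sq_nonneg (v (.inl a)), sq_nonneg (v (.inr a))]
    · have := h (f a) (Finset.mem_univ _)
      rw [hpf, hqf] at this
      simp only [Pi.zero_apply]
      nlinarith [sq_nonneg (v (.inl a)), sq_nonneg (v (.inr a))]
  have hle : ∑ m, d m * (p m ^ 2 + q m ^ 2) ≤
      e * ∑ m, (p m ^ 2 + q m ^ 2) := by
    rw [Finset.mul_sum]
    refine Finset.sum_le_sum fun m _ => ?_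
    by_cases hm : m ∈ Set.range f
    · obtain ⟨a, rfl⟩ := hm
      exact mul_le_mul_of_nonneg_right (hfd a) (by positivity)
    · rw [hp0 m hm, hq0 m hm]; simp
  set r := ∑ m, (p m ^ 2 + q m ^ 2) with hr_def
  have hc : (√r)⁻¹ ^ 2 * r = 1 := by
    rw [inv_pow, Real.sq_sqrt hr.le, inv_mul_cancel₀ hr.ne']
  set c := (√r)⁻¹
  refine ⟨c • p, c • q, ?_, ?_, ?_⟩
  · rw [← hc, hr_def, Finset.mul_sum]
    simp only [dotProduct, ← Finset.sum_add_distrib, Pi.smul_apply, smul_eq_mul]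
    exact Finset.sum_congr rfl fun m _ => by ring
  · have hcol (l : Fin k) (g g' : Fin n → ℝ)
        (h : ∑ m, (g m * p m + g' m * q m) = 0) :
        ∑ m, g m * (c * p m * (Pi.single j 1 : Fin k → ℝ) l) +
          ∑ m, g' m * (c * q m * (Pi.single j 1 : Fin k → ℝ) l) = 0 := by
      rw [← Finset.sum_add_distrib]
      calc _ = (c * (Pi.single j 1 : Fin k → ℝ) l) * ∑ m, (g m * p m + g' m * q m) := by
            rw [Finset.mul_sum]
            exact Finset.sum_congr rfl fun m _ => by ring
        _ = 0 := by rw [h, mul_zero]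
    have h1 (a : Fin k) := hTv (.inl a)
    have h2 (a : Fin k) := hTv (.inr a)
    ext (a | a) (l | l) <;>
      simp only [mul_apply, Fintype.sum_sum_type, pairColumns, fromBlocks_apply₁₁,
        fromBlocks_apply₁₂, fromBlocks_apply₂₁, fromBlocks_apply₂₂, vecMulVec_apply,
        Matrix.neg_apply, Pi.smul_apply, smul_eq_mul, Matrix.zero_apply]
    · exact hcol l _ _ (h1 a)
    · have := hcol l _ _ (h2 a)
      simp only [(hblk a _).1, (hblk a _).2.1] at this
      rw [← neg_eq_zero, ← this, neg_add_rev, ← Finset.sum_neg_distrib, ← Finset.sum_neg_distrib]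
      congr 1 <;> exact Finset.sum_congr rfl fun m _ => by ring
    · exact hcol l _ _ (h2 a)
    · have := hcol l _ _ (h1 a)
      simp only [(hblk a _).1, (hblk a _).2.1]
      rw [← this, add_comm]
      congr 1
      exact Finset.sum_congr rfl fun m _ => by ring
  · calc _ = c ^ 2 * ∑ m, d m * (p m ^ 2 + q m ^ 2) := by
          rw [Finset.mul_sum]
          exact Finset.sum_congr rfl fun m _ => by
            simp only [Pi.smul_apply, smul_eq_mul]; ring
      _ ≤ c ^ 2 * (e * r) := by gcongr
      _ = e * (c ^ 2 * r) := by ring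
      _ < lam j := by rw [hc, mul_one]; exact hj

lemma trace_fromBlocks_eq {k : ℕ} (A B C D : Matrix (Fin k) (Fin k) ℝ) :
    (fromBlocks A B C D).trace = A.trace + D.trace := by
  simp [trace, Fintype.sum_sum_type]

lemma transpose_mul_mul_eq_diagPair {n k : ℕ} {M : Matrix (Idx n) (Idx n) ℝ}
    {lam : Fin k → ℝ} {X : Matrix (Idx n) (Idx k) ℝ} (hX : Symplectic X)
    (heig : M * X = Jmat n * X * offPair lam) : Xᵀ * M * X = diagPair lam := by
  have h : Xᵀ * Jmat n * X = Jmat k := hX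
  rw [Matrix.mul_assoc, heig, ← Matrix.mul_assoc, ← Matrix.mul_assoc, h]
  simp [Jmat, offPair, diagPair, fromBlocks_multiply]

/-- A symplectic eigenvector set can be scaled to have larger trace. -/
lemma exists_symplectic_trace_gt {n k : ℕ} (hk1 : 1 ≤ k) {M : Matrix (Idx n) (Idx n) ℝ}
    {lam : Fin k → ℝ} (hlam : ∀ j, 0 < lam j) {X : Matrix (Idx n) (Idx k) ℝ}
    (hX : Symplectic X) (hXM : Xᵀ * M * X = diagPair lam) {ε : ℝ} (hε : 0 < ε) :
    ∃ Z : Matrix (Idx n) (Idx k) ℝ, Symplectic Z ∧ ‖Z - X‖ < ε ∧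
      (Xᵀ * M * X).trace < (Zᵀ * M * Z).trace := by
  let C (t : ℝ) : Matrix (Idx k) (Idx k) ℝ :=
    fromBlocks (diagonal fun _ => Real.exp t) 0 0 (diagonal fun _ => Real.exp (-t))
  have hcont : Continuous fun t => ‖X * C t - X‖ := by
    refine Continuous.norm (Continuous.sub (Continuous.matrix_mul continuous_const ?_)
      continuous_const)
    exact Continuous.matrix_fromBlocks (Continuous.matrix_diagonal (by fun_prop))
      continuous_const continuous_const (Continuous.matrix_diagonal (by fun_prop))
  have h0 : ‖X * C 0 - X‖ = 0 := by simp [C, diagonal_one]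
  have hev := (hcont.tendsto 0).eventually (gt_mem_nhds (h0.trans_lt hε))
  obtain ⟨t, ht, htpos⟩ := ((hev.filter_mono nhdsWithin_le_nhds).and
    (self_mem_nhdsWithin (s := Set.Ioi (0 : ℝ)))).exists
  have hexp : Real.exp t * Real.exp (-t) = 1 := by rw [← Real.exp_add]; simp
  refine ⟨X * C t, ?_, ht, ?_⟩
  · have h : Xᵀ * Jmat n * X = Jmat k := hX
    have : (C t)ᵀ * (Xᵀ * Jmat n * X) * C t = Jmat k := by
      rw [h]
      simp only [C, Jmat, fromBlocks_transpose, fromBlocks_multiply, diagonal_transpose,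
        transpose_zero, Matrix.mul_zero, Matrix.zero_mul, add_zero, zero_add, Matrix.mul_one,
        Matrix.mul_neg, Matrix.neg_mul, diagonal_mul_diagonal, hexp, mul_comm (Real.exp (-t)),
        diagonal_one, neg_zero]
    simpa only [Symplectic, transpose_mul, Matrix.mul_assoc] using this
  · have : (X * C t)ᵀ * M * (X * C t) = (C t)ᵀ * (Xᵀ * M * X) * C t := by
      simp only [transpose_mul, Matrix.mul_assoc]
    rw [this, hXM]
    simp only [C, diagPair, fromBlocks_transpose, fromBlocks_multiply, diagonal_transpose,
      transpose_zero, Matrix.mul_zero, Matrix.zero_mul, add_zero, zero_add, diagonal_mul_diagonal,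
      trace_fromBlocks_eq, trace_diagonal, ← Finset.sum_add_distrib]
    have : Nonempty (Fin k) := ⟨⟨0, hk1⟩⟩
    refine Finset.sum_lt_sum_of_nonempty Finset.univ_nonempty fun j _ => ?_
    have h1 : 1 < Real.exp t := Real.one_lt_exp_iff.mpr htpos
    have h2 : Real.exp (-t) < 1 := Real.exp_lt_one_iff.mpr (neg_lt_zero.mpr htpos)
    linear_combination mul_pos (hlam j) (pow_pos (sub_pos.mpr (h2.trans h1)) 2) - 2 * lam j * hexp

/-- Rotating the `j`-th pair of a symplectic eigenvector set towards an orthogonal pair of smaller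
energy decreases the trace. -/
lemma exists_symplectic_trace_lt {n k : ℕ} {M : Matrix (Idx n) (Idx n) ℝ} (hM : Mᵀ = M)
    {lam : Fin k → ℝ} {X A : Matrix (Idx n) (Idx k) ℝ} {j : Fin k}
    (hX : Symplectic X) (hXM : Xᵀ * M * X = diagPair lam)
    (hAJA : Aᵀ * Jmat n * A =
      fromBlocks 0 (diagonal (Pi.single j 1)) (-diagonal (Pi.single j 1)) 0)
    (hXJA : Xᵀ * Jmat n * A = 0) (hXMA : Xᵀ * M * A = 0)
    (htr : (Aᵀ * M * A).trace < 2 * lam j) {ε : ℝ} (hε : 0 < ε) :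
    ∃ Y : Matrix (Idx n) (Idx k) ℝ, Symplectic Y ∧ ‖Y - X‖ < ε ∧
      (Yᵀ * M * Y).trace < (Xᵀ * M * X).trace := by
  have hJ : (Jmat n)ᵀ = -Jmat n := by simp [Jmat, fromBlocks_transpose, fromBlocks_neg]
  have hAJX : Aᵀ * Jmat n * X = 0 := by
    have := congrArg transpose hXJA
    simpa [transpose_mul, hJ, Matrix.mul_assoc] using this
  have hAMX : Aᵀ * M * X = 0 := by
    have := congrArg transpose hXMA
    simpa [transpose_mul, hM, Matrix.mul_assoc] using this
  let w (t : ℝ) : Fin k → ℝ := fun l => if l = j then Real.cos t else 1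
  let Y (t : ℝ) : Matrix (Idx n) (Idx k) ℝ := X * diagPair (w t) + Real.sin t • A
  have hw : Continuous w := continuous_pi fun l => by
    by_cases h : l = j <;> simp only [w, h, if_true, if_false] <;> fun_prop
  have hsmul : Continuous fun t => Real.sin t • A :=
    continuous_matrix fun a b => Real.continuous_sin.mul continuous_const
  have hcont : Continuous fun t => ‖Y t - X‖ := by
    refine Continuous.norm (Continuous.sub (Continuous.add (Continuous.matrix_mul
      continuous_const ?_) hsmul) continuous_const)
    exact Continuous.matrix_fromBlocks (Continuous.matrix_diagonal hw)
      continuous_const continuous_const (Continuous.matrix_diagonal hw)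
  have h0 : ‖Y 0 - X‖ = 0 := by simp [Y, w, diagPair, diagonal_one]
  have hev := (hcont.tendsto 0).eventually (gt_mem_nhds (h0.trans_lt hε))
  obtain ⟨t, ht, htpos⟩ := ((hev.filter_mono nhdsWithin_le_nhds).and
    (Ioo_mem_nhdsGT Real.pi_pos)).exists
  have hsin : 0 < Real.sin t := Real.sin_pos_of_pos_of_lt_pi htpos.1 htpos.2
  have hsc := Real.sin_sq_add_cos_sq t
  have hform (N : Matrix (Idx n) (Idx n) ℝ) (h1 : Xᵀ * N * A = 0) (h2 : Aᵀ * N * X = 0) :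
      (Y t)ᵀ * N * Y t = diagPair (w t) * (Xᵀ * N * X) * diagPair (w t) +
        Real.sin t ^ 2 • (Aᵀ * N * A) := by
    have hC : (diagPair (w t))ᵀ = diagPair (w t) := by simp [diagPair]
    have e1 : diagPair (w t) * (Xᵀ * N * A) = 0 := by rw [h1, Matrix.mul_zero]
    have e2 : Aᵀ * N * X * diagPair (w t) = 0 := by rw [h2, Matrix.zero_mul]
    simp only [Matrix.mul_assoc] at e1 e2
    simp only [Y, transpose_add, transpose_mul, transpose_smul, Matrix.add_mul, Matrix.mul_add,
      Matrix.smul_mul, Matrix.mul_smul, Matrix.mul_assoc, e1, e2, smul_smul, smul_zero, add_zero,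
      zero_add, hC, sq]
  refine ⟨Y t, ?_, ht, ?_⟩
  · have h : Xᵀ * Jmat n * X = Jmat k := hX
    have hd : diagonal (fun l => w t l * w t l) + Real.sin t ^ 2 • diagonal (Pi.single j (1 : ℝ)) =
        1 := by
      rw [← diagonal_smul, diagonal_add, ← diagonal_one]
      congr 1
      ext l
      by_cases hl : l = j
      · subst hl
        simp [w]
        linarith
      · simp [w, hl]
    rw [Symplectic, hform _ hXJA hAJX, h, hAJA]
    simp only [diagPair, Jmat, fromBlocks_multiply, fromBlocks_smul, fromBlocks_add, smul_zero,
      Matrix.mul_zero, Matrix.zero_mul, Matrix.mul_one, Matrix.mul_neg, Matrix.neg_mul,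
      add_zero, zero_add, diagonal_mul_diagonal, smul_neg, ← neg_add, hd, neg_zero]
  · rw [hform _ hXMA hAMX, trace_add, trace_smul, hXM]
    simp only [diagPair, fromBlocks_multiply, Matrix.mul_zero, Matrix.zero_mul, add_zero,
      zero_add, diagonal_mul_diagonal, trace_fromBlocks_eq, trace_diagonal, smul_eq_mul]
    have hsum : ∑ l, w t l * lam l * w t l = ∑ l, lam l - Real.sin t ^ 2 * lam j := by
      rw [eq_sub_iff_add_eq, ← Finset.sum_erase_add _ _ (Finset.mem_univ j),
        ← Finset.sum_erase_add _ lam (Finset.mem_univ j), add_assoc]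
      congr 1
      · exact Finset.sum_congr rfl fun l hl => by simp [w, Finset.ne_of_mem_erase hl]
      · simp only [w, if_true]
        linear_combination lam j * hsc
    rw [hsum]
    nlinarith [mul_lt_mul_of_pos_left htr (pow_pos hsin 2)]

/-- a normalized symplectic eigenvector set associated with
symplectic eigenvalues `d_{i₁}, …, d_{i_k}`, at least one of which lies strictly
between `d_k` and `d_{n−k+1}`, is a saddle point of `tr(XᵀMX)` on `Sp(2k,2n)`:
arbitrarily close to `X` there are feasible points with strictly smaller and
strictly larger cost. -/
theorem saddle_point {n k : ℕ} (hk1 : 1 ≤ k) (hk : k ≤ n)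
    (M : Matrix (Idx n) (Idx n) ℝ) (hM : M.PosDef)
    (d : Fin n → ℝ) (hd : ∀ j, 0 < d j) (hmono : Monotone d)
    (hW : ∃ S : Matrix (Idx n) (Idx n) ℝ, Symplectic S ∧ Sᵀ * M * S = diagPair d)
    (i : Fin k → Fin n) (hi : StrictMono i)
    (X : Matrix (Idx n) (Idx k) ℝ) (hX : Symplectic X)
    (heig : M * X = Jmat n * X * offPair (fun j : Fin k => d (i j)))
    (hbetween : ∃ j : Fin k,
      d ⟨k - 1, by omega⟩ < d (i j) ∧ d (i j) < d ⟨n - k, by omega⟩) :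
    ∀ ε : ℝ, 0 < ε →
      ∃ Y Z : Matrix (Idx n) (Idx k) ℝ,
        Symplectic Y ∧ Symplectic Z ∧ ‖Y - X‖ < ε ∧ ‖Z - X‖ < ε ∧
        (Yᵀ * M * Y).trace < (Xᵀ * M * X).trace ∧
        (Xᵀ * M * X).trace < (Zᵀ * M * Z).trace := by
  intro ε hε
  obtain ⟨S, hS, hD⟩ := hW
  obtain ⟨j, hj, -⟩ := hbetween
  have hMt : Mᵀ = M := by simpa using hM.isHermitian.eq
  have hlam (l : Fin k) : 0 < d (i l) := hd _
  have hXM := transpose_mul_mul_eq_diagPair hX heig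
  have hT := offPair_transpose_mul_gram hMt hS hD heig
  obtain ⟨p, q, hpq, hTA, hlt⟩ := exists_pairColumns hk hd hlam hT
    (fun a => hmono (Fin.mk_le_mk.mpr (Nat.le_sub_one_of_lt a.isLt))) hj
  have hXJA : Xᵀ * Jmat n * (S * pairColumns p q j) = 0 := by
    rw [← Matrix.mul_assoc, hTA]
  have hXMt : Xᵀ * M = -((offPair fun l => d (i l))ᵀ * (Xᵀ * Jmat n)) := by
    have h := congrArg transpose heig
    have hJ : (Jmat n)ᵀ = -Jmat n := by simp [Jmat, fromBlocks_transpose, fromBlocks_neg]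
    simpa [transpose_mul, hMt, hJ] using h
  have hXMA : Xᵀ * M * (S * pairColumns p q j) = 0 := by
    rw [hXMt, Matrix.neg_mul, Matrix.mul_assoc, hXJA, Matrix.mul_zero, neg_zero]
  have hpull (N : Matrix (Idx n) (Idx n) ℝ) : (S * pairColumns p q j)ᵀ * N *
      (S * pairColumns p q j) = (pairColumns p q j)ᵀ * (Sᵀ * N * S) * pairColumns p q j := by
    simp only [transpose_mul, Matrix.mul_assoc]
  have hSJ : Sᵀ * Jmat n * S = Jmat n := hS
  obtain ⟨Y, hY, hYε, hYlt⟩ := exists_symplectic_trace_lt (A := S * pairColumns p q j) hMt hX hXM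
    (by rw [hpull, hSJ, pairColumns_transpose_mul_Jmat_mul j hpq]) hXJA hXMA
    (by rw [hpull, hD, trace_pairColumns_transpose_mul_diagPair_mul]; linarith) hε
  obtain ⟨Z, hZ, hZε, hZgt⟩ := exists_symplectic_trace_gt hk1 hlam hX hXM hε
  exact ⟨Y, Z, hY, hZ, hYε, hZε, hYlt, hZgt⟩
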